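/- Let p be an odd prime and let G be a non-Abelian finite p-group such that every non-linear irreducible complex character of G has kernel of order exactly p^m for a fixed integer m ≥ 1. Then the quotient group G/Z(G) is elementary Abelian. -/

import Mathlib

open CategoryTheory

/-- The kernel of the character of a complex representation `V` of `G`:
`ker χ = {g ∈ G : χ(g) = χ(1)}`. -/
noncomputable def charKer {G : Type} [Group G] (V : FDRep ℂ G) : Set G :=
  {g | V.character g = V.character 1}

/-- The center of the character of a complex representation `V` of `G`:
`Z(χ) = {g ∈ G : |χ(g)| = χ(1)}`. -/
noncomputable def charCenter {G : Type} [Group G] (V : FDRep ℂ G) : Set G :=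
  {g | (‖V.character g‖ : ℂ) = V.character 1}

/-- The `FDRep` attached to an irreducible complex representation of a finite group is simple. -/
theorem FDRep.simple_of_isIrreducible {G : Type} [Group G] [Fintype G] {V : Type}
    [AddCommGroup V] [Module ℂ V] [FiniteDimensional ℂ V] (ρ : Representation ℂ G V)
    [ρ.IsIrreducible] : Simple (FDRep.of ρ) := by
  rw [FDRep.simple_iff_char_is_norm_one]
  have hne : (Nat.card G : ℂ) ≠ 0 := by simp
  let _ : Invertible (Nat.card G : ℂ) := invertibleOfNonzero hne
  have h := Representation.char_orthonormal ρ ρ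
  rw [if_pos ⟨Representation.Equiv.refl ρ⟩, inv_mul_eq_one₀ hne] at h
  exact h.symm

/-- A minimal nonzero subrepresentation is irreducible. -/
theorem Subrepresentation.isIrreducible_of_isAtom {k G W : Type*} [Field k] [Monoid G]
    [AddCommGroup W] [Module k W] {ρ : Representation k G W} {σ : Subrepresentation ρ}
    (hσ : IsAtom σ) : σ.toRepresentation.IsIrreducible := by
  have hne : ∃ x ∈ σ, x ≠ 0 := by
    by_contra! h
    exact hσ.1 (le_bot_iff.1 fun x hx => by simpa using! h x hx)
  refine @IsSimpleOrder.mk _ _ _ ⟨⊥, ⊤, fun h => ?_⟩ fun T => ?_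
  · obtain ⟨x, hx, hx0⟩ := hne
    have hmem : (⟨x, hx⟩ : σ.toSubmodule) ∈ (⊥ : Subrepresentation σ.toRepresentation) := by
      rw [h]; trivial
    exact hx0 (congrArg Subtype.val ((Submodule.mem_bot k).1 hmem))
  · let T' : Subrepresentation ρ :=
      { toSubmodule := T.toSubmodule.map σ.toSubmodule.subtype
        apply_mem_toSubmodule := by
          rintro g _ ⟨x, hx, rfl⟩
          exact ⟨_, T.apply_mem_toSubmodule g hx, rfl⟩ }
    have hle : T' ≤ σ := by
      rintro _ ⟨x, -, rfl⟩
      exact x.2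
    rcases hσ.le_iff.1 hle with h | h
    · left
      refine le_bot_iff.1 fun x hx => ?_
      have hmem : (x : W) ∈ T' := ⟨x, hx, rfl⟩
      rw [h] at hmem
      exact (Submodule.mem_bot k).2 (Subtype.ext ((Submodule.mem_bot k).1 hmem))
    · right
      refine top_le_iff.1 fun x _ => ?_
      have hmem : (x : W) ∈ T' := by rw [h]; exact x.2
      obtain ⟨y, hy, hyx⟩ := hmem
      exact (Subtype.ext hyx : y = x) ▸ hy

/-- An element acting nontrivially on a representation of a finite group acts nontrivially on
one of its irreducible constituents. -/
theorem exists_simple_ρ_ne_one {G : Type} [Group G] [Fintype G] {W : Type} [AddCommGroup W]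
    [Module ℂ W] [FiniteDimensional ℂ W] (ρ : Representation ℂ G W) {w : G} (hw : ρ w ≠ 1) :
    ∃ V : FDRep ℂ G, Simple V ∧ V.ρ w ≠ 1 ∧ ∀ g, ρ g = 1 → V.ρ g = 1 := by
  by_contra! hcon
  apply hw
  have key : ∀ S : Submodule (MonoidAlgebra ℂ G) ρ.asModule, IsSimpleModule (MonoidAlgebra ℂ G) S →
      ∀ x ∈ S, ρ w (ρ.asModuleEquiv x) = ρ.asModuleEquiv x := by
    intro S hS x hx
    let σ := Subrepresentation.subrepresentationSubmoduleOrderIso.symm S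
    have hσ : IsAtom σ := (OrderIso.isAtom_iff _ S).2 (isSimpleModule_iff_isAtom.1 hS)
    have := Subrepresentation.isIrreducible_of_isAtom hσ
    have hone : ∀ g, ρ g = 1 → σ.toRepresentation g = 1 := by
      intro g hg
      ext x
      exact congrArg (fun f : Module.End ℂ W => f x) hg
    have hw1 : σ.toRepresentation w = 1 := by
      by_contra hne
      obtain ⟨g, hg, hg'⟩ := hcon (FDRep.of σ.toRepresentation)
        (FDRep.simple_of_isIrreducible _) hne
      exact hg' (hone g hg)
    exact congrArg Subtype.val (LinearMap.congr_fun hw1 ⟨x, hx⟩)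
  have htop := IsSemisimpleModule.sSup_simples_eq_top (MonoidAlgebra ℂ G) ρ.asModule
  rw [sSup_eq_iSup'] at htop
  ext v
  have hv : ρ.asModuleEquiv.symm v ∈ (⊤ : Submodule (MonoidAlgebra ℂ G) ρ.asModule) := trivial
  rw [← htop] at hv
  have := Submodule.iSup_induction _
    (motive := fun x => ρ w (ρ.asModuleEquiv x) = ρ.asModuleEquiv x) hv
    (fun S x hx => key S S.2 x hx) (by simp) (fun x y hx hy => by simp [hx, hy])
  simpa using this

/-- An element outside a normal subgroup `M` acts nontrivially in some irreducible representation
whose kernel contains `M`. -/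
theorem exists_simple_of_notMem {G : Type} [Group G] [Fintype G] (M : Subgroup G) [M.Normal]
    {w : G} (hw : w ∉ M) :
    ∃ V : FDRep ℂ G, Simple V ∧ V.ρ w ≠ 1 ∧ ∀ g ∈ M, V.ρ g = 1 := by
  obtain ⟨V, hV, hVw, hVM⟩ := exists_simple_ρ_ne_one (Representation.ofMulAction ℂ G (G ⧸ M))
    (w := w) (by
      intro h
      have := LinearMap.congr_fun h (MonoidAlgebra.single ((1 : G) : G ⧸ M) (1 : ℂ))
      rw [Representation.ofMulAction_single] at this
      have := MonoidAlgebra.single_left_injective one_ne_zero this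
      rw [MulAction.Quotient.smul_coe, smul_eq_mul, mul_one, QuotientGroup.mk_one,
        QuotientGroup.eq_one_iff] at this
      exact hw this)
  refine ⟨V, hV, hVw, fun g hg => hVM g ?_⟩
  refine MonoidAlgebra.lhom_ext' fun q => ?_
  ext
  induction q using QuotientGroup.induction_on with
  | H x =>
    have : g • (x : G ⧸ M) = x := by
      rw [MulAction.Quotient.smul_coe, smul_eq_mul, eq_comm, QuotientGroup.eq, ← mul_assoc]
      simpa using ‹M.Normal›.conj_mem g hg x⁻¹
    simp [Representation.ofMulAction_single, this]

/-- A representation in which some element of the commutator subgroup acts nontrivially is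
non-linear. -/
theorem one_lt_finrank_of_ρ_ne_one {G : Type} [Group G] (V : FDRep ℂ G) {w : G}
    (hw : w ∈ commutator G) (hV : V.ρ w ≠ 1) : 1 < Module.finrank ℂ V := by
  by_contra! h
  obtain ⟨v, hv⟩ := finrank_le_one_iff.1 h
  have hcomm : ∀ f g : Module.End ℂ V, f * g = g * f := by
    intro f g
    obtain ⟨a, ha⟩ := hv (f v)
    obtain ⟨b, hb⟩ := hv (g v)
    ext x
    obtain ⟨c, rfl⟩ := hv x
    simp only [Module.End.mul_apply, map_smul, ← ha, ← hb]
    rw [smul_comm a b]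
  have hle : commutator G ≤ V.ρ.toHomUnits.ker := by
    rw [commutator_def, Subgroup.commutator_le]
    intro a _ b _
    rw [MonoidHom.mem_ker, map_commutatorElement, commutatorElement_eq_one_iff_mul_comm]
    exact Units.ext (hcomm _ _)
  exact hV (congrArg Units.val (hle hw))

/-- An endomorphism of finite order of a complex vector space whose trace is the dimension is the
identity. -/
theorem Module.End.eq_one_of_trace_eq_finrank {V : Type*} [AddCommGroup V] [Module ℂ V]
    [FiniteDimensional ℂ V] (f : Module.End ℂ V) {k : ℕ} (hk : k ≠ 0) (hf : f ^ k = 1)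
    (htr : LinearMap.trace ℂ V f = Module.finrank ℂ V) : f = 1 := by
  have hroot : ∀ μ ∈ (LinearMap.charpoly f).roots, μ ^ k = 1 := by
    intro μ hμ
    have hμ' := (Module.End.hasEigenvalue_iff_isRoot_charpoly f μ).2
      (Polynomial.isRoot_of_mem_roots hμ)
    obtain ⟨v, hv⟩ := hμ'.exists_hasEigenvector
    have := hv.pow_apply k
    rw [hf] at this
    have h2 : (1 - μ ^ k) • v = 0 := by rw [sub_smul, ← this]; simp
    rcases smul_eq_zero.1 h2 with h | h
    · exact (sub_eq_zero.1 h).symm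
    · exact absurd h hv.2
  have hsplit : (LinearMap.charpoly f).Splits := IsAlgClosed.splits _
  rw [Module.End.trace_eq_sum_roots_charpoly_of_splits hsplit] at htr
  have hcard : (LinearMap.charpoly f).roots.card = Module.finrank ℂ V := by
    rw [← hsplit.natDegree_eq_card_roots, LinearMap.charpoly_natDegree]
  have hre : ∀ s : Multiset ℂ, (∀ μ ∈ s, μ ^ k = 1) →
      s.sum.re ≤ s.card ∧ ((s.card : ℝ) ≤ s.sum.re → ∀ μ ∈ s, μ = 1) := by
    intro s
    induction s using Multiset.induction_on with
    | empty => simp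
    | cons a s ih =>
      intro h
      obtain ⟨h1, h2⟩ := ih fun μ hμ => h μ (Multiset.mem_cons_of_mem hμ)
      have hn : ‖a‖ = 1 := Complex.norm_eq_one_of_pow_eq_one (h a (Multiset.mem_cons_self a s)) hk
      have ha : a.re ≤ 1 := hn ▸ Complex.re_le_norm a
      simp only [Multiset.sum_cons, Complex.add_re, Multiset.card_cons, Nat.cast_add, Nat.cast_one]
      refine ⟨by linarith, fun h3 μ hμ => ?_⟩
      rcases Multiset.mem_cons.1 hμ with rfl | hμ
      · have hr : μ.re = 1 := by linarith
        have h4 := Complex.sq_norm_sub_sq_re μ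
        rw [hn, hr] at h4
        exact Complex.ext hr (pow_eq_zero_iff two_ne_zero |>.1 (by simpa using h4.symm))
      · exact h2 (by linarith) μ hμ
  have hall := (hre _ hroot).2 (by rw [htr, hcard]; simp)
  have hpow : (minpoly ℂ f) ∣ (Polynomial.X - Polynomial.C 1) ^ Module.finrank ℂ V := by
    have : LinearMap.charpoly f = (Polynomial.X - Polynomial.C 1) ^ Module.finrank ℂ V := by
      rw [hsplit.eq_prod_roots_of_monic (LinearMap.charpoly_monic f),
        Multiset.eq_replicate.2 ⟨hcard, hall⟩]
      simp
    exact this ▸ LinearMap.minpoly_dvd_charpoly f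
  have hdvd : minpoly ℂ f ∣ Polynomial.X ^ k - 1 := minpoly.dvd _ _ (by simp [hf])
  have hsq : Squarefree (minpoly ℂ f) :=
    (((Polynomial.X_pow_sub_one_separable_iff).2 (by simpa using hk)).squarefree).squarefree_of_dvd hdvd
  have hlin : minpoly ℂ f ∣ Polynomial.X - Polynomial.C 1 := hsq.isRadical _ _ hpow
  have := (minpoly.dvd_iff).1 hlin
  simpa [sub_eq_zero] using this

/-- The kernel of the character of a representation of a finite group is the kernel of the
representation. -/
theorem charKer_eq_ker {G : Type} [Group G] [Fintype G] (V : FDRep ℂ G) :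
    charKer V = (V.ρ.toHomUnits.ker : Set G) := by
  ext g
  simp only [charKer, Set.mem_ofPred_eq, SetLike.mem_coe, MonoidHom.mem_ker, Units.ext_iff,
    MonoidHom.coe_toHomUnits, Units.val_one]
  refine ⟨fun h => ?_, fun h => ?_⟩
  · rw [FDRep.char_one] at h
    refine Module.End.eq_one_of_trace_eq_finrank _ (k := Fintype.card G) Fintype.card_ne_zero ?_ h
    rw [← map_pow, pow_card_eq_one, map_one]
  · exact congrArg (LinearMap.trace ℂ V) (h.trans (map_one V.ρ).symm)

open scoped commutatorElement

/-- In a finite `p`-group whose non-linear irreducible characters all have kernels of the same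
order, an element `w` of the commutator subgroup is trivial as soon as it dies in every quotient
in which some `c` in the commutator subgroup becomes central of exponent `p`. -/
theorem eq_one_of_forall_central_pow {p m : ℕ} (hp : p.Prime) {G : Type} [Group G] [Fintype G]
    (hpG : IsPGroup p G)
    (hker : ∀ V : FDRep ℂ G, Simple V → 1 < Module.finrank ℂ V →
      Nat.card (charKer V) = p ^ m)
    {c w : G} (hc : c ∈ commutator G) (hw : w ∈ commutator G)
    (hcw : ∀ K : Subgroup G, K.Normal → (∀ g, ⁅c, g⁆ ∈ K) → c ^ p ∈ K → w ∈ K) : w = 1 := by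
  by_contra hne
  obtain ⟨V, hV, hVw, -⟩ := exists_simple_of_notMem (⊥ : Subgroup G) (w := w) (by simpa using hne)
  have hcard := hker V hV (one_lt_finrank_of_ρ_ne_one V hw hVw)
  rw [charKer_eq_ker] at hcard
  set K := V.ρ.toHomUnits.ker with hK
  have hwK : w ∉ K := fun h => hVw (congrArg Units.val h)
  have : Fact p.Prime := ⟨hp⟩
  have hQ : IsPGroup p (G ⧸ K) := hpG.to_quotient K
  have : Nontrivial (G ⧸ K) := ⟨(w : G ⧸ K), 1, fun h => hwK ((QuotientGroup.eq_one_iff w).1 h)⟩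
  have := hQ.center_nontrivial
  obtain ⟨z, hz⟩ := exists_prime_orderOf_dvd_card' (G := Subgroup.center (G ⧸ K)) p
    ((hQ.to_subgroup _).card_eq_or_dvd.resolve_left Finite.one_lt_card.ne')
  have hnorm : (Subgroup.zpowers (z : G ⧸ K)).Normal :=
    ⟨fun x hx g => by
      obtain ⟨n, rfl⟩ := Subgroup.mem_zpowers_iff.1 hx
      rwa [Subgroup.mem_center_iff.1 (Subgroup.zpow_mem _ z.2 n) g, mul_inv_cancel_right]⟩
  let M := (Subgroup.zpowers (z : G ⧸ K)).comap (QuotientGroup.mk' K)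
  have hKM : K ≤ M := fun g hg => by
    have : (g : G ⧸ K) = 1 := (QuotientGroup.eq_one_iff g).2 hg
    simp [M, this]
  have hcM : c ∈ M := by
    by_contra hcM
    obtain ⟨V', hV', hVc, hVM⟩ := exists_simple_of_notMem M hcM
    have hcard' := hker V' hV' (one_lt_finrank_of_ρ_ne_one V' hc hVc)
    rw [charKer_eq_ker] at hcard'
    have hMK : M ≤ V'.ρ.toHomUnits.ker := fun g hg => Units.ext (hVM g hg)
    have hle : Nat.card M ≤ Nat.card K :=
      (Subgroup.card_le_of_le hMK).trans (hcard'.trans hcard.symm).le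
    have hKMeq : K = M := Subgroup.eq_of_le_of_card_ge hKM hle
    obtain ⟨g, hg⟩ := QuotientGroup.mk_surjective (z : G ⧸ K)
    have hgM : g ∈ M := by simp [M, hg]
    rw [← hKMeq, ← QuotientGroup.eq_one_iff, hg] at hgM
    rw [OneMemClass.coe_eq_one.1 hgM, orderOf_one] at hz
    exact hp.one_lt.ne hz
  obtain ⟨n, hn⟩ := Subgroup.mem_zpowers_iff.1 (Subgroup.mem_comap.1 hcM)
  rw [QuotientGroup.mk'_apply] at hn
  refine hwK (hcw K inferInstance (fun g => ?_) ?_)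
  · rw [← QuotientGroup.eq_one_iff, ← QuotientGroup.mk'_apply, map_commutatorElement,
      commutatorElement_eq_one_iff_mul_comm, QuotientGroup.mk'_apply, ← hn]
    exact (Subgroup.mem_center_iff.1 (Subgroup.zpow_mem _ z.2 n) _).symm
  · have hzp : (z : G ⧸ K) ^ p = 1 := by
      rw [← hz, ← Subgroup.coe_pow, pow_orderOf_eq_one, Subgroup.coe_one]
    rw [← QuotientGroup.eq_one_iff, QuotientGroup.mk_pow, ← hn, ← zpow_natCast, ← zpow_mul,
      mul_comm, zpow_mul, zpow_natCast, hzp, one_zpow]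

/-- If every non-linear irreducible complex character of the non-Abelian finite `p`-group
`G` (`p` odd) has kernel of order exactly `p ^ m` for a fixed `m ≥ 1`, then `G / Z(G)`
is elementary Abelian. -/
theorem quotient_center_elementaryAbelian_of_kernels (p m : ℕ) (hp : p.Prime)
    (hodd : Odd p) (hm : 1 ≤ m) (G : Type) [Group G] [Fintype G] (hpG : IsPGroup p G)
    (hnab : ¬ ∀ a b : G, a * b = b * a)
    (hker : ∀ V : FDRep ℂ G, Simple V → 1 < Module.finrank ℂ V →
      Nat.card (charKer V) = p ^ m) :
    (∀ x y : G ⧸ Subgroup.center G, x * y = y * x) ∧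
      (∀ x : G ⧸ Subgroup.center G, x ^ p = 1) := by
  have hmem : ∀ x y : G, ⁅x, y⁆ ∈ commutator G := fun x y =>
    Subgroup.commutator_mem_commutator (Subgroup.mem_top x) (Subgroup.mem_top y)
  have hclass : ∀ x y z : G, ⁅⁅x, y⁆, z⁆ = 1 := fun x y z =>
    eq_one_of_forall_central_pow hp hpG hker (hmem x y) (hmem _ z) fun _ _ h _ => h z
  have hexp : ∀ x y : G, ⁅x, y⁆ ^ p = 1 := fun x y =>
    eq_one_of_forall_central_pow hp hpG hker (hmem x y) (Subgroup.pow_mem _ (hmem x y) p)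
      fun _ _ _ h => h
  refine ⟨fun x y => ?_, fun x => ?_⟩
  · induction x using QuotientGroup.induction_on with | H x => ?_
    induction y using QuotientGroup.induction_on with | H y => ?_
    rw [← commutatorElement_eq_one_iff_mul_comm, ← QuotientGroup.mk'_apply,
      ← QuotientGroup.mk'_apply, ← map_commutatorElement, QuotientGroup.mk'_apply,
      QuotientGroup.eq_one_iff, Subgroup.mem_center_iff]
    exact fun g => (commutatorElement_eq_one_iff_mul_comm.1 (hclass x y g)).symm
  · induction x using QuotientGroup.induction_on with | H x => ?_
    rw [← QuotientGroup.mk_pow, QuotientGroup.eq_one_iff, Subgroup.mem_center_iff]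
    intro g
    have hcomm : Commute ⁅g, x⁆ x := commutatorElement_eq_one_iff_mul_comm.1 (hclass g x x)
    have hconj : g * x ^ p * g⁻¹ = x ^ p := by
      rw [← conj_pow, show g * x * g⁻¹ = ⁅g, x⁆ * x by simp [commutatorElement_def],
        hcomm.mul_pow, hexp, one_mul]
    exact mul_inv_eq_iff_eq_mul.1 hconj
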